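/- Let n ≥ 3 be odd and let G be the cycle graph on n vertices, with eigenvalues 0 = λ₀ < λ₁ ≤ … ≤ λ_{n−1} of the normalized Laplacian 𝓛 = I − (1/2)A, and for η ∈ [0,1) define g(η) = max_{i=1,…,n−1} |η + (1−η)(1 − λᵢ)|. Then, writing s = sin(θ_n) and c = cos(θ_n) with θ_n = π/(2n): ς := (λ₁+λ_{n−1})/2 = c² + 4s²c² > 1, the unique minimizer of g over [0,1) is η* = (4s²c² − s²)/(4s²c² + c²), and the minimum value is g(η*) = (1 − 4s²)/(1 + 4s²). -/

import Mathlib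

/-- A nonsingular matrix intertwining two diagonal matrices matches their diagonals up to a
permutation. -/
theorem exists_perm_of_diagonal_mul_eq_mul_diagonal {ι K : Type*} [Fintype ι] [DecidableEq ι]
    [Field K] {d e : ι → K} {Q : Matrix ι ι K} (hQ : Q.det ≠ 0)
    (h : Matrix.diagonal d * Q = Q * Matrix.diagonal e) :
    ∃ σ : Equiv.Perm ι, ∀ i, e i = d (σ i) := by
  by_contra! hne
  refine hQ ?_
  rw [Matrix.det_apply]
  refine Finset.sum_eq_zero fun σ _ => ?_
  obtain ⟨i, hi⟩ := hne σ
  have hentry := congrFun (congrFun h (σ i)) i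
  rw [Matrix.diagonal_mul, Matrix.mul_diagonal, mul_comm] at hentry
  have hzero : Q (σ i) i = 0 := by
    by_contra hq
    exact hi (mul_left_cancel₀ hq hentry).symm
  rw [Finset.prod_eq_zero (f := fun j => Q (σ j) j) (Finset.mem_univ i) hzero, smul_zero]

/-- Powers of an `n`-th root of unity form a left eigenvector of the adjacency matrix of the
cycle graph. -/
theorem vecMul_adjMatrix_cycleGraph {n : ℕ} (hn : 3 ≤ n) {z : ℂ} (hz : z ^ n = 1) (j : Fin n) :
    Matrix.vecMul (fun l : Fin n => z ^ (l : ℕ)) ((SimpleGraph.cycleGraph n).adjMatrix ℂ) j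
      = (z + z⁻¹) * z ^ (j : ℕ) := by
  obtain ⟨m, rfl⟩ := Nat.exists_eq_add_of_le' hn
  have hz0 : z ≠ 0 := by
    rintro rfl
    simp at hz
  have hsucc (l : Fin (m + 3)) : z ^ ((l + 1 : Fin (m + 3)) : ℕ) = z * z ^ (l : ℕ) := by
    rw [Fin.val_add, ← pow_eq_pow_mod _ hz, Fin.val_one, pow_succ']
  have hpred : z ^ ((j - 1 : Fin (m + 3)) : ℕ) = z⁻¹ * z ^ (j : ℕ) := by
    have := hsucc (j - 1)
    rw [sub_add_cancel] at this
    rw [this, inv_mul_cancel_left₀ hz0]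
  have hne : j - 1 ≠ j + 1 := by
    intro h
    have h2 : (1 : Fin (m + 3)) + 1 = 0 := by
      simpa [add_assoc] using sub_eq_iff_eq_add.1 h
    simp [Fin.ext_iff, Fin.val_add, Nat.mod_eq_of_lt (show 2 < m + 3 by omega)] at h2
  rw [SimpleGraph.adjMatrix_vecMul_apply, SimpleGraph.cycleGraph_neighborFinset,
    Finset.sum_pair hne, hsucc, hpred]
  ring

open Real in
/-- The eigenvalues of the normalized Laplacian of the cycle graph, with multiplicity, are
`1 - cos (2πk/n)` for `k = 0, …, n - 1`. -/
theorem exists_perm_eigenvalues_cycleGraph {n : ℕ} (hn : 3 ≤ n) {lam : Fin n → ℝ}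
    {P : Matrix (Fin n) (Fin n) ℝ} (hP : IsUnit P.det)
    (h : ((1 : Matrix (Fin n) (Fin n) ℝ)
          - (2 : ℝ)⁻¹ • (SimpleGraph.cycleGraph n).adjMatrix ℝ) * P
        = P * Matrix.diagonal lam) :
    ∃ σ : Equiv.Perm (Fin n), ∀ i, lam i = 1 - cos (2 * π * (σ i : ℕ) / n) := by
  have hω := Complex.isPrimitiveRoot_exp n (by omega)
  set ω : ℂ := Complex.exp (2 * π * Complex.I / n) with hωdef
  set V : Matrix (Fin n) (Fin n) ℂ := Matrix.vandermonde fun k : Fin n => ω ^ (k : ℕ) with hV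
  set d : Fin n → ℂ := fun k => ((1 - cos (2 * π * (k : ℕ) / n) : ℝ) : ℂ) with hd
  set PC : Matrix (Fin n) (Fin n) ℂ := P.map Complex.ofRealHom with hPC
  set A : Matrix (Fin n) (Fin n) ℂ := (SimpleGraph.cycleGraph n).adjMatrix ℂ with hA
  have hVdet : V.det ≠ 0 := Matrix.det_vandermonde_ne_zero_iff.2 fun a b hab =>
    Fin.ext (hω.pow_inj a.2 b.2 hab)
  have hPdet : PC.det ≠ 0 := by
    rw [hPC, ← RingHom.mapMatrix_apply, ← RingHom.map_det]
    simpa using hP.ne_zero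
  have hVL : V * (1 - (2 : ℂ)⁻¹ • A) = Matrix.diagonal d * V := by
    ext k j
    have hz : (ω ^ (k : ℕ)) ^ n = 1 := by rw [← pow_mul, mul_comm, pow_mul, hω.pow_eq_one, one_pow]
    have hcos : ω ^ (k : ℕ) + (ω ^ (k : ℕ))⁻¹ = 2 * Complex.cos (2 * π * (k : ℕ) / n) := by
      rw [hωdef, ← Complex.exp_nat_mul, ← Complex.exp_neg, Complex.cos]
      ring_nf
    have hmul : (V * A) k j = (ω ^ (k : ℕ) + (ω ^ (k : ℕ))⁻¹) * (ω ^ (k : ℕ)) ^ (j : ℕ) :=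
      vecMul_adjMatrix_cycleGraph hn hz j
    rw [Matrix.mul_sub, Matrix.mul_one, Matrix.mul_smul, Matrix.sub_apply, Matrix.smul_apply,
      hmul, hcos, Matrix.diagonal_mul, hV, Matrix.vandermonde_apply, hd]
    push_cast
    rw [smul_eq_mul]
    ring
  have hLP : (1 - (2 : ℂ)⁻¹ • A) * PC = PC * Matrix.diagonal fun i => (lam i : ℂ) := by
    have := congrArg (fun M => M.map Complex.ofRealHom) h
    simp only [Matrix.map_mul] at this
    convert this using 2
    · ext i j
      by_cases hij : i = j <;> by_cases hadj : (SimpleGraph.cycleGraph n).Adj i j <;>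
        simp [hA, hij, hadj, SimpleGraph.adjMatrix_apply]
    · rw [Matrix.diagonal_map (map_zero _)]
      rfl
  obtain ⟨σ, hσ⟩ := exists_perm_of_diagonal_mul_eq_mul_diagonal
    (d := d) (e := fun i => (lam i : ℂ)) (Q := V * PC)
    (by rw [Matrix.det_mul]; exact mul_ne_zero hVdet hPdet)
    (by rw [← Matrix.mul_assoc, ← hVL, Matrix.mul_assoc, hLP, Matrix.mul_assoc])
  exact ⟨σ, fun i => Complex.ofReal_injective (hσ i)⟩

open Real in
theorem cos_two_pi_mul_sub_div {n k : ℕ} (hn : 0 < n) (hk : k ≤ n) :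
    cos (2 * π * ((n - k : ℕ) : ℝ) / n) = cos (2 * π * k / n) := by
  have hn0 : (n : ℝ) ≠ 0 := by positivity
  rw [Nat.cast_sub hk, ← cos_two_pi_sub]
  congr 1
  field_simp
  ring

open Real in
theorem cos_two_pi_mul_div_antitone {n j k : ℕ} (hn : 0 < n) (hjk : j ≤ k) (hk : 2 * k ≤ n) :
    cos (2 * π * k / n) ≤ cos (2 * π * j / n) := by
  have hk' : 2 * (k : ℝ) ≤ n := by exact_mod_cast hk
  have hn0 : (0 : ℝ) < n := by exact_mod_cast hn
  refine cos_le_cos_of_nonneg_of_le_pi (by positivity) ?_ (by gcongr)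
  rw [div_le_iff₀ hn0]
  nlinarith [pi_pos]

open Real in
theorem cos_two_pi_mul_div_le {n k : ℕ} (hk0 : k ≠ 0) (hk : k < n) :
    cos (2 * π * k / n) ≤ cos (2 * π / n) := by
  rcases le_total (2 * k) n with h | h
  · simpa using cos_two_pi_mul_div_antitone (j := 1) (by omega) (by omega) h
  · rw [← cos_two_pi_mul_sub_div (by omega) hk.le]
    simpa using cos_two_pi_mul_div_antitone (j := 1) (k := n - k) (n := n)
      (by omega) (by omega) (by omega)

open Real in
theorem cos_two_pi_mul_half_div (m : ℕ) :
    cos (2 * π * m / (2 * m + 1 : ℕ)) = -cos (π / (2 * m + 1 : ℕ)) := by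
  rw [← cos_pi_sub]
  congr 1
  push_cast
  field_simp
  ring

open Real in
theorem neg_cos_pi_div_le {n k : ℕ} (hodd : Odd n) (hk : k < n) :
    -cos (π / n) ≤ cos (2 * π * k / n) := by
  obtain ⟨m, rfl⟩ := hodd
  rw [← cos_two_pi_mul_half_div]
  rcases le_total k m with h | h
  · exact cos_two_pi_mul_div_antitone (by omega) h (by omega)
  · rw [← cos_two_pi_mul_sub_div (k := k) (by omega) hk.le]
    rcases h.eq_or_lt with rfl | h
    · exact (cos_two_pi_mul_sub_div (by omega) (by omega)).ge
    · exact cos_two_pi_mul_div_antitone (by omega) (by omega) (by omega)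

/-- The maximum of `|η + (1 - η)(1 - λ)|` over a finite set of values `λ` with least element `a`
and greatest element `b` is attained at one of these two. -/
theorem sup'_abs_affine_eq {ι : Type*} {S : Finset ι} (hS : S.Nonempty) {lam : ι → ℝ} {a b : ℝ}
    (hlow : ∀ i ∈ S, a ≤ lam i) (hup : ∀ i ∈ S, lam i ≤ b)
    (ha : ∃ i ∈ S, lam i = a) (hb : ∃ i ∈ S, lam i = b) {η : ℝ} (hη : η < 1) :
    S.sup' hS (fun i => |η + (1 - η) * (1 - lam i)|)
      = max (1 - (1 - η) * a) ((1 - η) * b - 1) := by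
  have hη' : 0 ≤ 1 - η := by linarith
  apply le_antisymm
  · refine Finset.sup'_le _ _ fun i hi => ?_
    have h1 := mul_le_mul_of_nonneg_left (hlow i hi) hη'
    have h2 := mul_le_mul_of_nonneg_left (hup i hi) hη'
    rw [abs_le']
    exact ⟨le_max_of_le_left (by linarith), le_max_of_le_right (by linarith)⟩
  · obtain ⟨i, hi, rfl⟩ := ha
    obtain ⟨j, hj, rfl⟩ := hb
    refine max_le ?_ ?_
    · refine le_trans ?_ (Finset.le_sup' (fun i => |η + (1 - η) * (1 - lam i)|) hi)
      exact le_trans (by linarith) (le_abs_self _)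
    · refine le_trans ?_ (Finset.le_sup' (fun i => |η + (1 - η) * (1 - lam i)|) hj)
      exact le_trans (by linarith) (neg_le_abs _)

open Real in
/-- For odd `n ≥ 3` and the cycle graph on `n` vertices, with eigenvalues
`0 = λ₀ < λ₁ ≤ … ≤ λ_{n-1}` of the normalized Laplacian `𝓛 = I - (1/2)A` (listed with
multiplicity in increasing order, via a diagonalization) and
`g(η) = max_{i=1,…,n-1} |η + (1-η)(1-λᵢ)|` for `η ∈ [0,1)`: writing `s = sin(θ_n)`,
`c = cos(θ_n)`, `θ_n = π/(2n)`, one has `ς = (λ₁+λ_{n-1})/2 = c² + 4s²c² > 1`, the unique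
minimizer of `g` over `[0,1)` is `η* = (4s²c² - s²)/(4s²c² + c²)`, and the minimum value is
`g(η*) = (1 - 4s²)/(1 + 4s²)`. -/
theorem stmt_18 {n : ℕ} (hn : 3 ≤ n) (hodd : Odd n)
    (lam : Fin n → ℝ) (hmono : Monotone lam) (hlam0 : lam ⟨0, by omega⟩ = 0)
    (hdiag : ∃ P : Matrix (Fin n) (Fin n) ℝ, IsUnit P.det ∧
      ((1 : Matrix (Fin n) (Fin n) ℝ)
          - (2 : ℝ)⁻¹ • (SimpleGraph.cycleGraph n).adjMatrix ℝ) * P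
        = P * Matrix.diagonal lam)
    (g : ℝ → ℝ)
    (hg : ∀ η : ℝ, g η = Finset.sup' (Finset.univ.erase (⟨0, by omega⟩ : Fin n))
      ⟨⟨1, by omega⟩, by simp [Finset.mem_erase, Fin.ext_iff]⟩
      fun i => |η + (1 - η) * (1 - lam i)|) :
    let s : ℝ := sin (π / (2 * n))
    let c : ℝ := cos (π / (2 * n))
    ((lam ⟨1, by omega⟩ + lam ⟨n - 1, by omega⟩) / 2 = c ^ 2 + 4 * s ^ 2 * c ^ 2
    ∧ 1 < (lam ⟨1, by omega⟩ + lam ⟨n - 1, by omega⟩) / 2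
    ∧ (4 * s ^ 2 * c ^ 2 - s ^ 2) / (4 * s ^ 2 * c ^ 2 + c ^ 2) ∈ Set.Ico (0 : ℝ) 1
    ∧ (∀ η ∈ Set.Ico (0 : ℝ) 1,
        η ≠ (4 * s ^ 2 * c ^ 2 - s ^ 2) / (4 * s ^ 2 * c ^ 2 + c ^ 2) →
        g ((4 * s ^ 2 * c ^ 2 - s ^ 2) / (4 * s ^ 2 * c ^ 2 + c ^ 2)) < g η)
    ∧ g ((4 * s ^ 2 * c ^ 2 - s ^ 2) / (4 * s ^ 2 * c ^ 2 + c ^ 2))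
        = (1 - 4 * s ^ 2) / (1 + 4 * s ^ 2)) := by
  intro s c
  obtain ⟨P, hP, hLP⟩ := hdiag
  obtain ⟨σ, hσ⟩ := exists_perm_eigenvalues_cycleGraph hn hP hLP
  have hn0 : (0 : ℝ) < n := by positivity
  have hn3 : (3 : ℝ) ≤ n := by exact_mod_cast hn
  have hπ := pi_pos
  have hsc : s ^ 2 + c ^ 2 = 1 := sin_sq_add_cos_sq _
  have hcos1 : cos (π / n) = 2 * c ^ 2 - 1 := by
    rw [← cos_two_mul]
    congr 1
    field_simp
  have hcos2 : cos (2 * π / n) = 1 - 8 * s ^ 2 * c ^ 2 := by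
    have h : cos (2 * π / n) = 2 * cos (π / n) ^ 2 - 1 := by
      rw [← cos_two_mul]
      congr 1
      ring
    rw [h, hcos1]
    linear_combination (8 * c ^ 2) * hsc
  have hc : 0 < c := cos_pos_of_mem_Ioo
    ⟨by linarith [show 0 < π / (2 * (n : ℝ)) by positivity], by gcongr; linarith⟩
  have hangle : 2 * π / n ≤ π := by
    rw [div_le_iff₀ hn0]
    nlinarith
  have hcos_lt : cos (2 * π / n) < cos (π / n) :=
    cos_lt_cos_of_nonneg_of_le_pi (by positivity) hangle (by gcongr; linarith)
  have hcos_lt_one : cos (2 * π / n) < 1 := by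
    simpa using cos_lt_cos_of_nonneg_of_le_pi le_rfl hangle (by positivity)
  have hσ0 : ∀ i, i ≠ ⟨0, by omega⟩ → (σ i : ℕ) ≠ 0 := by
    have h0 : (σ ⟨0, by omega⟩ : ℕ) = 0 := by
      by_contra hne
      have h := hσ ⟨0, by omega⟩
      linarith [cos_two_pi_mul_div_le hne (σ ⟨0, by omega⟩).2]
    intro i hi hi0
    exact hi (σ.injective (Fin.ext (hi0.trans h0.symm)))
  have hlow : ∀ i, i ≠ ⟨0, by omega⟩ → 8 * s ^ 2 * c ^ 2 ≤ lam i := by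
    intro i hi
    linarith [hσ i, cos_two_pi_mul_div_le (hσ0 i hi) (σ i).2]
  have hup : ∀ i, lam i ≤ 2 * c ^ 2 := by
    intro i
    linarith [hσ i, neg_cos_pi_div_le hodd (σ i).2]
  have hfirst : lam ⟨1, by omega⟩ = 8 * s ^ 2 * c ^ 2 := by
    refine le_antisymm ?_ (hlow _ (by simp [Fin.ext_iff]))
    have hval : lam (σ.symm ⟨1, by omega⟩) = 8 * s ^ 2 * c ^ 2 := by
      rw [hσ, Equiv.apply_symm_apply, Nat.cast_one, mul_one, hcos2]
      ring
    rw [← hval]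
    refine hmono (Fin.mk_le_of_le_val (Nat.one_le_iff_ne_zero.2 fun h => ?_))
    rw [show σ.symm ⟨1, by omega⟩ = ⟨0, by omega⟩ from Fin.ext h, hlam0] at hval
    linarith
  have hlast : lam ⟨n - 1, by omega⟩ = 2 * c ^ 2 := by
    refine le_antisymm (hup _) ?_
    obtain ⟨m, hm⟩ := hodd
    have hval : lam (σ.symm ⟨m, by omega⟩) = 2 * c ^ 2 := by
      rw [hσ, Equiv.apply_symm_apply]
      have h := cos_two_pi_mul_half_div m
      rw [← hm] at h
      linarith
    rw [← hval]
    exact hmono (Fin.le_def.2 (Nat.le_sub_one_of_lt (Fin.is_lt _)))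
  have hrate : ∀ η < 1, g η = max (1 - (1 - η) * (8 * s ^ 2 * c ^ 2))
      ((1 - η) * (2 * c ^ 2) - 1) := by
    intro η hη
    rw [hg]
    exact sup'_abs_affine_eq _ (fun i hi => hlow i (Finset.ne_of_mem_erase hi))
      (fun i _ => hup i) ⟨⟨1, by omega⟩, by simp [Fin.ext_iff], hfirst⟩
      ⟨⟨n - 1, by omega⟩, by simp [Fin.ext_iff]; omega, hlast⟩ hη
  have hpos : 0 < 4 * s ^ 2 * c ^ 2 + c ^ 2 := by positivity
  have hs4 : 0 < 1 + 4 * s ^ 2 := by positivity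
  have hgap : 0 < 4 * s ^ 2 * c ^ 2 - s ^ 2 := by nlinarith
  set η₀ := (4 * s ^ 2 * c ^ 2 - s ^ 2) / (4 * s ^ 2 * c ^ 2 + c ^ 2) with hη₀
  have hη₀_sub : 1 - η₀ = 1 / (4 * s ^ 2 * c ^ 2 + c ^ 2) := by
    rw [hη₀, one_sub_div hpos.ne']
    congr 1
    linear_combination hsc
  have hη₀_lt : η₀ < 1 := by
    have : 0 < 1 - η₀ := by rw [hη₀_sub]; positivity
    linarith
  have hleft : 1 - (1 - η₀) * (8 * s ^ 2 * c ^ 2) = (1 - 4 * s ^ 2) / (1 + 4 * s ^ 2) := by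
    rw [hη₀_sub, show 4 * s ^ 2 * c ^ 2 + c ^ 2 = c ^ 2 * (1 + 4 * s ^ 2) by ring]
    field_simp
    ring
  have hright : (1 - η₀) * (2 * c ^ 2) - 1 = (1 - 4 * s ^ 2) / (1 + 4 * s ^ 2) := by
    rw [hη₀_sub, show 4 * s ^ 2 * c ^ 2 + c ^ 2 = c ^ 2 * (1 + 4 * s ^ 2) by ring]
    field_simp
    ring
  have hmin : g η₀ = (1 - 4 * s ^ 2) / (1 + 4 * s ^ 2) := by
    rw [hrate η₀ hη₀_lt, hleft, hright, max_self]
  have hsum : (lam ⟨1, by omega⟩ + lam ⟨n - 1, by omega⟩) / 2 = c ^ 2 + 4 * s ^ 2 * c ^ 2 := by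
    rw [hfirst, hlast]
    ring
  refine ⟨hsum, by rw [hsum]; linarith, ⟨by positivity, hη₀_lt⟩, fun η hη hne => ?_, hmin⟩
  rw [hmin, hrate η hη.2]
  rcases hne.lt_or_gt with h | h
  · refine lt_max_of_lt_right ?_
    rw [← hright]
    have : 0 < 2 * c ^ 2 := by positivity
    nlinarith
  · refine lt_max_of_lt_left ?_
    rw [← hleft]
    have : 0 < 8 * s ^ 2 * c ^ 2 := by linarith
    nlinarith
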